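/- arXiv:1309.0963 — 2 statements merged into one kernel-verified Lean document; each statement's English description precedes it below -/
import Mathlib

section
/- For all complex numbers s, t, u, v, the polynomial F and all six of its partial derivatives ∂F/∂X₀, ∂F/∂X₁, ∂F/∂X₂, ∂F/∂X₃, ∂F/∂X₆, ∂F/∂X₇ vanish at the point (X₀, X₁, X₂, X₃, X₆, X₇) = (su, sv, tu, tv, tv, tv). In particular the quadric surface Q₂₂ = {X₀X₃ − X₁X₂ = X₃ − X₆ = X₃ − X₇ = 0}, parametrized by ((s:t),(u:v)) ↦ (su : sv : tu : tv : tv : tv), is contained in the singular locus of the hypersurface 𝒳 = {F = 0} ⊂ P⁵. -/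
open MvPolynomial in
/-- The degree-10 polynomial `F = F₁₀ − X₀X₁X₂X₃X₆X₇·F₄` defining the Picard modular
fourfold `𝒳 ⊂ P⁵`. The variables `X 0, X 1, X 2, X 3, X 4, X 5` stand for the
coordinates `X₀, X₁, X₂, X₃, X₆, X₇`, and `Sᵢ` is the `i`-th elementary symmetric
polynomial in the five squares `X₁², X₂², X₃², X₆², X₇²`. -/
noncomputable def Fpoly : MvPolynomial (Fin 6) ℂ :=
  let a := X 1 ^ 2; let b := X 2 ^ 2; let c := X 3 ^ 2; let d := X 4 ^ 2; let e := X 5 ^ 2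
  let S1 := a + b + c + d + e
  let S2 := a*b + a*c + a*d + a*e + b*c + b*d + b*e + c*d + c*e + d*e
  let S3 := a*b*c + a*b*d + a*b*e + a*c*d + a*c*e + a*d*e + b*c*d + b*c*e + b*d*e + c*d*e
  let S4 := a*b*c*d + a*b*c*e + a*b*d*e + a*c*d*e + b*c*d*e
  let S5 := a*b*c*d*e
  let F4 := -6*S1^2 + 16*S2 + 4*S1*(X 0)^2 + 2*(X 0)^4
  let F10 := S1*S2^2 - 3*S1^2*S3 + 12*S1*S4 - 48*S5 + (-S2^2 + 2*S1*S3 + 4*S4)*(X 0)^2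
      + S3*(X 0)^4
  F10 - X 0 * X 1 * X 2 * X 3 * X 4 * X 5 * F4

open MvPolynomial in
/-- For all `s, t, u, v ∈ ℂ`, the polynomial `F` and all six of its partial derivatives
vanish at `(X₀,X₁,X₂,X₃,X₆,X₇) = (su, sv, tu, tv, tv, tv)`. In particular the quadric
surface `Q₂₂`, parametrized by `((s:t),(u:v)) ↦ (su : sv : tu : tv : tv : tv)`, is
contained in the singular locus of the hypersurface `𝒳 = {F = 0} ⊂ P⁵`. -/
theorem stmt_10 (s t u v : ℂ) :
    eval ![s*u, s*v, t*u, t*v, t*v, t*v] Fpoly = 0 ∧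
    ∀ i : Fin 6, eval ![s*u, s*v, t*u, t*v, t*v, t*v] (pderiv i Fpoly) = 0 := by
  have pderiv_ofNat (i : Fin 6) (n : ℕ) [n.AtLeastTwo] :
      pderiv i (OfNat.ofNat n : MvPolynomial (Fin 6) ℂ) = 0 :=
    (pderiv i).map_natCast n
  refine ⟨?_, fun i ↦ ?_⟩
  · simp [Fpoly]
    ring
  · fin_cases i <;>
    · simp [Fpoly, Derivation.leibniz, Derivation.leibniz_pow, pderiv_X, pderiv_ofNat]
      ring
end

section
/- Let ω ∈ ℂ be a primitive cube root of unity and define the three vectors w₁ := (3, 0, 0, 0, 0, −1−2ω), w₂ := (0, 1, 0, ω, −ω², 0), w₃ := (0, 0, 1, −ω², −ω, 0) in ℂ⁶ (coordinates (X₀, X₁, X₂, X₃, X₆, X₇)). Then for all a, b, c ∈ ℂ, the polynomial F and all six of its partial derivatives vanish at the point a·w₁ + b·w₂ + c·w₃. In particular the projective plane P(W₃) spanned by w₁, w₂, w₃ is contained in the singular locus of the hypersurface 𝒳 = {F = 0} ⊂ P⁵. -/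
/-- The value of `F` at a point with `X₀ = x₀`, where `x` is one of the other five coordinates,
`T₁`, `T₂`, `T₃` are the elementary symmetric polynomials in the squares of the remaining four, and
`N` is the product of those four. -/
def fpolyValue (x₀ x T₁ T₂ T₃ N : ℂ) : ℂ :=
  let S1 := x ^ 2 + T₁
  let S2 := T₂ + x ^ 2 * T₁
  let S3 := T₃ + x ^ 2 * T₂
  let S4 := N ^ 2 + x ^ 2 * T₃
  S1 * S2 ^ 2 - 3 * S1 ^ 2 * S3 + 12 * S1 * S4 - 48 * (x ^ 2 * N ^ 2)
    + (-S2 ^ 2 + 2 * S1 * S3 + 4 * S4) * x₀ ^ 2 + S3 * x₀ ^ 4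
    - x₀ * x * N * (-6 * S1 ^ 2 + 16 * S2 + 4 * S1 * x₀ ^ 2 + 2 * x₀ ^ 4)

/-- The partial derivative of `fpolyValue` in `x₀`. -/
def fpolyPartialZero (x₀ x T₁ T₂ T₃ N : ℂ) : ℂ :=
  let S1 := x ^ 2 + T₁
  let S2 := T₂ + x ^ 2 * T₁
  let S3 := T₃ + x ^ 2 * T₂
  let S4 := N ^ 2 + x ^ 2 * T₃
  2 * x₀ * (-S2 ^ 2 + 2 * S1 * S3 + 4 * S4) + 4 * x₀ ^ 3 * S3
    - x * N * (-6 * S1 ^ 2 + 16 * S2 + 4 * S1 * x₀ ^ 2 + 2 * x₀ ^ 4)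
    - x₀ * x * N * (8 * S1 * x₀ + 8 * x₀ ^ 3)

/-- The partial derivative of `fpolyValue` in `x`. -/
def fpolyPartial (x₀ x T₁ T₂ T₃ N : ℂ) : ℂ :=
  let S1 := x ^ 2 + T₁
  let S2 := T₂ + x ^ 2 * T₁
  let S3 := T₃ + x ^ 2 * T₂
  let S4 := N ^ 2 + x ^ 2 * T₃
  2 * x * (S2 ^ 2 + 2 * S1 * S2 * T₁ - 6 * S1 * S3 - 3 * S1 ^ 2 * T₂ + 12 * S4 + 12 * S1 * T₃
      - 48 * N ^ 2 + (-2 * S2 * T₁ + 2 * S3 + 2 * S1 * T₂ + 4 * T₃) * x₀ ^ 2 + T₂ * x₀ ^ 4)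
    - x₀ * N * (-6 * S1 ^ 2 + 16 * S2 + 4 * S1 * x₀ ^ 2 + 2 * x₀ ^ 4)
    - x₀ * x * N * (2 * x) * (-12 * S1 + 16 * T₁ + 4 * x₀ ^ 2)

theorem fpolyValue_eq_zero {t : ℂ} (ht : t ^ 2 = -3) {a x₀ x e₁ e₂ m : ℂ} (h₀ : x₀ = 3 * a)
    (hx : x = -t * a) (h₁ : e₁ = 0) (h₂ : e₂ = 2 * t * m) (e₃ : ℂ) :
    fpolyValue x₀ x e₁ e₂ e₃ m = 0 := by
  subst h₀ hx h₁ h₂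
  simp only [fpolyValue]
  grind

theorem fpolyPartialZero_eq_zero {t : ℂ} (ht : t ^ 2 = -3) {a x₀ x e₁ e₂ m : ℂ} (h₀ : x₀ = 3 * a)
    (hx : x = -t * a) (h₁ : e₁ = 0) (h₂ : e₂ = 2 * t * m) (e₃ : ℂ) :
    fpolyPartialZero x₀ x e₁ e₂ e₃ m = 0 := by
  subst h₀ hx h₁ h₂
  simp only [fpolyPartialZero]
  grind

theorem fpolyPartial_eq_zero {t : ℂ} (ht : t ^ 2 = -3) {a x₀ x e₁ e₂ m : ℂ} (h₀ : x₀ = 3 * a)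
    (hx : x = -t * a) (h₁ : e₁ = 0) (h₂ : e₂ = 2 * t * m) (e₃ : ℂ) :
    fpolyPartial x₀ x e₁ e₂ e₃ m = 0 := by
  subst h₀ hx h₁ h₂
  simp only [fpolyPartial]
  grind

theorem fpolyPartial_eq_zero_of_quadruple {t : ℂ} (ht : t ^ 2 = -3) (a x p q r : ℂ)
    (hs : x ^ 2 + p ^ 2 + q ^ 2 + r ^ 2 = 0)
    (he : x ^ 2 * (p ^ 2 + q ^ 2 + r ^ 2) + (p ^ 2 * q ^ 2 + p ^ 2 * r ^ 2 + q ^ 2 * r ^ 2) =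
      2 * t * (x * p * q * r)) :
    fpolyPartial (3 * a) x (p ^ 2 + q ^ 2 + r ^ 2 + (-t * a) ^ 2)
      (p ^ 2 * q ^ 2 + p ^ 2 * r ^ 2 + q ^ 2 * r ^ 2 + (-t * a) ^ 2 * (p ^ 2 + q ^ 2 + r ^ 2))
      ((p * q * r) ^ 2 + (-t * a) ^ 2 * (p ^ 2 * q ^ 2 + p ^ 2 * r ^ 2 + q ^ 2 * r ^ 2))
      (p * q * r * (-t * a)) = 0 := by
  have h₁ : p ^ 2 + q ^ 2 + r ^ 2 = -x ^ 2 := by linear_combination hs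
  have h₂ : p ^ 2 * q ^ 2 + p ^ 2 * r ^ 2 + q ^ 2 * r ^ 2 = 2 * t * x * (p * q * r) + x ^ 4 := by
    linear_combination he - x ^ 2 * hs
  have h₃ : (-t * a) ^ 2 = -3 * a ^ 2 := by linear_combination a ^ 2 * ht
  rw [h₁, h₂, h₃]
  generalize p * q * r = n
  simp only [fpolyPartial]
  grind

open MvPolynomial in
theorem pderiv_ofNat {σ R : Type*} [CommSemiring R] (i : σ) (n : ℕ) [n.AtLeastTwo] :
    pderiv i (ofNat(n) : MvPolynomial σ R) = 0 :=
  (pderiv i).map_natCast n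

open MvPolynomial in
theorem eval_Fpoly_and_pderiv_eq_zero {t : ℂ} (ht : t ^ 2 = -3) (a : ℂ) (x : Fin 6 → ℂ)
    (h0 : x 0 = 3 * a) (h5 : x 5 = -t * a)
    (hs : x 1 ^ 2 + x 2 ^ 2 + x 3 ^ 2 + x 4 ^ 2 = 0)
    (he : x 1 ^ 2 * x 2 ^ 2 + x 1 ^ 2 * x 3 ^ 2 + x 1 ^ 2 * x 4 ^ 2 + x 2 ^ 2 * x 3 ^ 2
      + x 2 ^ 2 * x 4 ^ 2 + x 3 ^ 2 * x 4 ^ 2 = 2 * t * (x 1 * x 2 * x 3 * x 4)) :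
    eval x Fpoly = 0 ∧ ∀ j, eval x (pderiv j Fpoly) = 0 := by
  have hF := fpolyValue_eq_zero ht h0 h5 hs he (x 1 ^ 2 * x 2 ^ 2 * x 3 ^ 2 + x 1 ^ 2 * x 2 ^ 2 * x 4 ^ 2
    + x 1 ^ 2 * x 3 ^ 2 * x 4 ^ 2 + x 2 ^ 2 * x 3 ^ 2 * x 4 ^ 2)
  have hF0 := fpolyPartialZero_eq_zero ht h0 h5 hs he (x 1 ^ 2 * x 2 ^ 2 * x 3 ^ 2 + x 1 ^ 2 * x 2 ^ 2 * x 4 ^ 2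
    + x 1 ^ 2 * x 3 ^ 2 * x 4 ^ 2 + x 2 ^ 2 * x 3 ^ 2 * x 4 ^ 2)
  have hF5 := fpolyPartial_eq_zero ht h0 h5 hs he (x 1 ^ 2 * x 2 ^ 2 * x 3 ^ 2 + x 1 ^ 2 * x 2 ^ 2 * x 4 ^ 2
    + x 1 ^ 2 * x 3 ^ 2 * x 4 ^ 2 + x 2 ^ 2 * x 3 ^ 2 * x 4 ^ 2)
  have hF1 := fpolyPartial_eq_zero_of_quadruple ht a (x 1) (x 2) (x 3) (x 4)
    (by linear_combination hs) (by linear_combination he)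
  have hF2 := fpolyPartial_eq_zero_of_quadruple ht a (x 2) (x 1) (x 3) (x 4)
    (by linear_combination hs) (by linear_combination he)
  have hF3 := fpolyPartial_eq_zero_of_quadruple ht a (x 3) (x 1) (x 2) (x 4)
    (by linear_combination hs) (by linear_combination he)
  have hF4 := fpolyPartial_eq_zero_of_quadruple ht a (x 4) (x 1) (x 2) (x 3)
    (by linear_combination hs) (by linear_combination he)
  rw [← h0, ← h5] at hF1 hF2 hF3 hF4
  simp only [fpolyValue, fpolyPartialZero, fpolyPartial] at hF hF0 hF1 hF2 hF3 hF4 hF5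
  refine ⟨?_, fun j => ?_⟩
  · simp only [Fpoly, map_add, map_sub, map_mul, map_neg, map_pow, map_ofNat, eval_X]
    linear_combination hF
  · fin_cases j <;>
      simp [Fpoly, pderiv_X, pderiv_ofNat]
    · linear_combination hF0
    · linear_combination hF1
    · linear_combination hF2
    · linear_combination hF3
    · linear_combination hF4
    · linear_combination hF5

open MvPolynomial in
/-- Let `ω` be a primitive cube root of unity and let
`w₁ = (3,0,0,0,0,−1−2ω)`, `w₂ = (0,1,0,ω,−ω²,0)`, `w₃ = (0,0,1,−ω²,−ω,0)` in ℂ⁶.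
Then `F` and all six of its partial derivatives vanish at every point
`a·w₁ + b·w₂ + c·w₃`; in particular the projective plane `P(W₃)` spanned by
`w₁, w₂, w₃` lies in the singular locus of `𝒳 = {F = 0} ⊂ P⁵`. -/
theorem stmt_13 (ω : ℂ) (hω : IsPrimitiveRoot ω 3) (a b c : ℂ) :
    eval (fun i => a * (![3, 0, 0, 0, 0, -1 - 2*ω] i)
        + b * (![0, 1, 0, ω, -ω^2, 0] i)
        + c * (![0, 0, 1, -ω^2, -ω, 0] i)) Fpoly = 0 ∧
    ∀ j : Fin 6,
      eval (fun i => a * (![3, 0, 0, 0, 0, -1 - 2*ω] i)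
          + b * (![0, 1, 0, ω, -ω^2, 0] i)
          + c * (![0, 0, 1, -ω^2, -ω, 0] i)) (pderiv j Fpoly) = 0 := by
  have h : ω ^ 2 + ω + 1 = 0 := by
    have h1 : ω - 1 ≠ 0 := sub_ne_zero.mpr (hω.ne_one (by norm_num))
    exact mul_left_cancel₀ h1 (by linear_combination hω.pow_eq_one)
  refine eval_Fpoly_and_pderiv_eq_zero (t := 1 + 2 * ω) ?_ a _ ?_ ?_ ?_ ?_
  · linear_combination 4 * h
  · simp [mul_comm]
  · simp
    ring
  · simp
    grind
  · simp
    grind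
end
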